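/- Let k = 12ℓ + k' with k' ∈ {0,4,6,8,10,14}, let 0 ≤ m ≤ ℓ, and let x_1,…,x_{ℓ−m} be the zeros of the Faber polynomial F_{k,m} counted with multiplicity. Then for every integer n with 1 ≤ n ≤ ℓ − m, the power sum ∑_{i=1}^{ℓ−m} x_i^n equals A_n·k + B_n·m + C_n(k'), where A_n = (1/2π)∫_{π/2}^{2π/3} j(e^{iθ})^n dθ, B_n = −c_n(0) with c_n(0) the coefficient of q^0 in the q-expansion of j^n, C_n(k') = 0 for k' ∈ {0,4,8}, and C_n(k') = −1728^n/2 for k' ∈ {6,10,14}. Moreover A_n is an integer. -/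

import Mathlib

open Complex Polynomial Real MeasureTheory Filter Topology

noncomputable section

/-- `q = e^{2πiz}`. -/
def qexp (z : ℂ) : ℂ := Complex.exp (2 * Real.pi * Complex.I * z)

/-- The normalized Eisenstein series `E_k(z) = (1/2) ∑_{gcd(c,d)=1} (cz+d)^{-k}`,
with the convention `E_0 = 1`. -/
def Eis (k : ℕ) (z : ℂ) : ℂ :=
  if k = 0 then 1
  else (1 / 2) * ∑' p : ℤ × ℤ, if Int.gcd p.1 p.2 = 1 then 1 / ((p.1 : ℂ) * z + (p.2 : ℂ)) ^ k else 0

/-- The modular discriminant `Δ(z) = q ∏_{n ≥ 1} (1 - q^n)^24`, `q = e^{2πiz}`. -/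
def Disc (z : ℂ) : ℂ := qexp z * ∏' n : ℕ, (1 - qexp z ^ (n + 1)) ^ 24

/-- The modular `j`-invariant `j = E₄³ / Δ`. -/
def jinv (z : ℂ) : ℂ := Eis 4 z ^ 3 / Disc z

/-- The coefficient of `q^d` in the Fourier/`q`-expansion of a `1`-periodic function
holomorphic on the upper half-plane, computed at height `1`. -/
def qCoeff (f : ℂ → ℂ) (d : ℤ) : ℂ :=
  ∫ x in (0:ℝ)..1,
    f (x + Complex.I) * Complex.exp (-(2 * Real.pi * Complex.I * d * (x + Complex.I)))

/-- `c_N(d)`: the coefficient of `q^d` in the Laurent expansion of `j^N`. -/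
def cj (N : ℕ) (d : ℤ) : ℂ := qCoeff (fun z => jinv z ^ N) d

/-- `A_n = (1/2π) ∫_{π/2}^{2π/3} j(e^{iθ})^n dθ`. -/
def Acoef (n : ℕ) : ℂ :=
  (1 / (2 * Real.pi)) *
    ∫ θ in (Real.pi / 2)..(2 * Real.pi / 3), jinv (Complex.exp (θ * Complex.I)) ^ n

/-- `B_n = -c_n(0)`, where `c_n(0)` is the coefficient of `q^0` in `j^n`. -/
def Bcoef (n : ℕ) : ℂ := - cj n 0

/-- `C_n(k') = 0` for `k' ∈ {0,4,8}` and `C_n(k') = -1728^n/2` for `k' ∈ {6,10,14}`. -/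
def Ccoef (n k' : ℕ) : ℂ := if k' = 6 ∨ k' = 10 ∨ k' = 14 then -(1728 : ℂ) ^ n / 2 else 0

/-- Real-valued version of `A_n` (recall `j` is real on the arc). -/
def AcoefR (n : ℕ) : ℝ :=
  (1 / (2 * Real.pi)) *
    ∫ θ in (Real.pi / 2)..(2 * Real.pi / 3), (jinv (Complex.exp (θ * Complex.I)) ^ n).re

/-- Real-valued version of `B_n = -c_n(0)` (recall `c_n(0)` is an integer). -/
def BcoefR (n : ℕ) : ℝ := - (cj n 0).re

/-- Real-valued version of `C_n(k')`. -/
def CcoefR (n k' : ℕ) : ℝ := if k' = 6 ∨ k' = 10 ∨ k' = 14 then -(1728 : ℝ) ^ n / 2 else 0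

/-- `f` is the `m`-th element `f_{k,m} = q^m + O(q^{ℓ+1})` of the Miller basis of `M_k`,
`k = 12ℓ + k'`: it is holomorphic on the upper half-plane, weight-`k` modular for
`SL₂(ℤ)`, and has a convergent `q`-expansion whose coefficients in degrees `≤ ℓ`
are `δ_{d,m}`. -/
def IsMillerForm (ℓ k' m : ℕ) (f : ℂ → ℂ) : Prop :=
  (∀ z : ℂ, 0 < z.im → DifferentiableAt ℂ f z) ∧
  (∀ z : ℂ, 0 < z.im → f (z + 1) = f z) ∧
  (∀ z : ℂ, 0 < z.im → f (-1 / z) = z ^ (12 * ℓ + k') * f z) ∧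
  (∃ a : ℕ → ℂ,
    (∀ z : ℂ, 0 < z.im →
      Summable (fun n : ℕ => a n * qexp z ^ n) ∧ f z = ∑' n : ℕ, a n * qexp z ^ n) ∧
    (∀ d : ℕ, d ≤ ℓ → a d = if d = m then 1 else 0))

/-- `F` is the Faber polynomial of `f = f_{k,m}`, `k = 12ℓ + k'`: the monic polynomial
of degree `ℓ - m` with `f = Δ^ℓ ⬝ E_{k'} ⬝ F(j)`. -/
def IsFaber (ℓ k' m : ℕ) (f : ℂ → ℂ) (F : Polynomial ℂ) : Prop :=
  F.Monic ∧ F.natDegree = ℓ - m ∧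
  ∀ z : ℂ, 0 < z.im → f z = Disc z ^ ℓ * Eis k' z * F.eval (jinv z)

/-- The sum of the `n`-th powers of the zeros of `F`, counted with multiplicity. -/
def powerSumRoots (F : Polynomial ℂ) (n : ℕ) : ℂ := (F.roots.map (fun x => x ^ n)).sum

/-- The (finite) solutions of `d_1 + 2 d_2 + ⋯ + n d_n = n` in nonnegative integers,
indexed by `Fin n` (so index `t : Fin n` stands for `d_{t+1}`).  Note any solution
automatically has `d_t ≤ n`. -/
def sols (n : ℕ) : Finset (Fin n → ℕ) :=
  (Fintype.piFinset fun _ : Fin n => Finset.range (n + 1)).filter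
    (fun d => ∑ t : Fin n, ((t : ℕ) + 1) * d t = n)



/-- The Euler operator `q d/dq` on power series. -/
def th (h : PowerSeries ℂ) : PowerSeries ℂ := PowerSeries.X * PowerSeries.derivative ℂ h

lemma coeff_th (h : PowerSeries ℂ) (d : ℕ) :
    PowerSeries.coeff d (th h) = d * PowerSeries.coeff d h := by
  rcases d with _ | d
  · simp [th]
  · simp [th, PowerSeries.coeff_succ_X_mul, PowerSeries.coeff_derivative]; ring

lemma th_mul (a b : PowerSeries ℂ) : th (a * b) = th a * b + a * th b := by
  simp [th, Derivation.leibniz]; ring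

lemma th_pow (a : PowerSeries ℂ) (n : ℕ) : th (a ^ (n + 1)) = (n + 1 : ℕ) * a ^ n * th a := by
  simp [th, Derivation.leibniz_pow]; ring

/-- constant term of `j^n` times the logarithmic derivative of `h`. -/
def LL (w : PowerSeries ℂ) (n : ℕ) (h : PowerSeries ℂ) : ℂ :=
  PowerSeries.coeff n (w ^ n * (th h * h⁻¹))

lemma LL_mul (w : PowerSeries ℂ) (n : ℕ) {a b : PowerSeries ℂ}
    (ha : PowerSeries.constantCoeff a ≠ 0) (hb : PowerSeries.constantCoeff b ≠ 0) :
    LL w n (a * b) = LL w n a + LL w n b := by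
  unfold LL
  rw [← map_add, ← mul_add, th_mul, PowerSeries.mul_inv_rev]
  congr 2
  have h1 := PowerSeries.mul_inv_cancel a ha
  have h2 := PowerSeries.mul_inv_cancel b hb
  linear_combination (th a * a⁻¹) * h2 + (th b * b⁻¹) * h1

lemma LL_one (w : PowerSeries ℂ) (n : ℕ) : LL w n 1 = 0 := by
  simp [LL, th]

lemma LL_pow (w : PowerSeries ℂ) (n : ℕ) {a : PowerSeries ℂ}
    (ha : PowerSeries.constantCoeff a ≠ 0) (k : ℕ) :
    LL w n (a ^ k) = k * LL w n a := by
  induction k with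
  | zero => simp [LL_one]
  | succ k ih => rw [pow_succ, LL_mul w n (by simp [ha]) ha, ih]; push_cast; ring

lemma LL_prod (w : PowerSeries ℂ) (n : ℕ) (s : Multiset ℂ) (g : ℂ → PowerSeries ℂ)
    (hg : ∀ x, PowerSeries.constantCoeff (g x) ≠ 0) :
    LL w n (s.map g).prod = (s.map fun x => LL w n (g x)).sum := by
  induction s using Multiset.induction_on with
  | empty => simp [LL_one]
  | cons a s ih =>
    simp only [Multiset.map_cons, Multiset.prod_cons, Multiset.sum_cons]
    rw [LL_mul w n (hg a), ih]
    rw [map_multiset_prod]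
    apply Multiset.prod_ne_zero
    simp [hg]

lemma coeff_aux (w : PowerSeries ℂ) (N : ℕ) :
    PowerSeries.coeff (N + 1) ((th w - w) * w ^ N) = 0 := by
  have h := coeff_th (w ^ (N + 1)) (N + 1)
  rw [th_pow] at h
  have h2 : ((N + 1 : ℕ) : PowerSeries ℂ) * w ^ N * th w
      = PowerSeries.C ((N + 1 : ℕ) : ℂ) * (w ^ N * th w) := by
    simp [mul_assoc]
  rw [h2, PowerSeries.coeff_C_mul] at h
  have h3 := mul_left_cancel₀ (Nat.cast_ne_zero.mpr (Nat.succ_ne_zero N) : ((N + 1 : ℕ) : ℂ) ≠ 0) h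
  rw [sub_mul, map_sub, mul_comm (th w), h3, ← pow_succ', sub_self]

lemma LL_lin (w : PowerSeries ℂ) (hw : PowerSeries.constantCoeff w = 1) (n : ℕ) (x : ℂ) :
    LL w n (w - PowerSeries.C x * PowerSeries.X) = PowerSeries.coeff n (w ^ n) - x ^ n := by
  set q : PowerSeries ℂ := PowerSeries.C x * PowerSeries.X with hq
  have hc : PowerSeries.constantCoeff (w - q) ≠ 0 := by simp [hq, hw]
  have hi := PowerSeries.mul_inv_cancel _ hc
  have hth : th (w - q) = (w - q) + (th w - w) := by
    have : th q = q := by simp [hq, th, mul_comm]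
    have h2 : th (w - q) = th w - th q := by simp [th, mul_sub]
    rw [h2, this]; ring
  have hgeo := (Commute.all w q).geom_sum₂_mul n
  have key : w ^ n * (th (w - q) * (w - q)⁻¹) = w ^ n +
      ((∑ i ∈ Finset.range n, w ^ i * q ^ (n - 1 - i)) * (th w - w)
        + q ^ n * ((th w - w) * (w - q)⁻¹)) := by
    rw [hth]
    have : w ^ n = (∑ i ∈ Finset.range n, w ^ i * q ^ (n - 1 - i)) * (w - q) + q ^ n := by
      rw [hgeo]; ring
    linear_combination (w ^ n) * hi + (th w - w) * (w-q)⁻¹ * this +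
       (∑ i ∈ Finset.range n, w ^ i * q ^ (n - 1 - i)) * (th w - w) * hi
  unfold LL
  rw [key, map_add, map_add, Finset.sum_mul, map_sum, Finset.sum_eq_zero]
  · have : q ^ n = PowerSeries.X ^ n * PowerSeries.C (x ^ n) := by
      simp [hq, mul_pow, mul_comm]
    rw [this, mul_assoc, PowerSeries.coeff_X_pow_mul']
    simp [th, hw, hq]
    ring
  · intro i hi
    have hi := Finset.mem_range.mp hi
    have : w ^ i * q ^ (n - 1 - i) * (th w - w) = PowerSeries.X ^ (n - 1 - i) *
       (PowerSeries.C (x ^ (n - 1 - i)) * ((th w - w) * w ^ i)) := by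
      simp [hq, mul_pow]; ring
    rw [this, PowerSeries.coeff_X_pow_mul', if_pos (by omega), PowerSeries.coeff_C_mul,
      show n - (n - 1 - i) = i + 1 by omega, coeff_aux, mul_zero]

/-- The formal power series identity behind the theorem. -/
lemma formal_main (ℓ m n : ℕ) (w D e4 e6 ek u : PowerSeries ℂ) (R : Multiset ℂ) (α β : ℕ)
    (hw : PowerSeries.constantCoeff w = 1) (hD : PowerSeries.constantCoeff D = 1)
    (h4 : PowerSeries.constantCoeff e4 = 1) (h6 : PowerSeries.constantCoeff e6 = 1)
    (hn2 : n ≤ ℓ - m) (hm : m ≤ ℓ)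
    (hwD : D * w = e4 ^ 3) (he6 : e6 ^ 2 = D * (w - PowerSeries.C 1728 * PowerSeries.X))
    (hn1 : 1 ≤ n)
    (hek : ek = e4 ^ α * e6 ^ β) (hR : R.card = ℓ - m)
    (hu : u = D ^ ℓ * ek * (R.map fun x => w - PowerSeries.C x * PowerSeries.X).prod)
    (hu0 : ∀ d, 1 ≤ d → d ≤ n → PowerSeries.coeff d u = 0) :
    (R.map fun x => x ^ n).sum = (LL w n e4 / 4) * (12 * ℓ + 4 * α + 6 * β)
      - m * PowerSeries.coeff n (w ^ n) - β * 1728 ^ n / 2 := by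
  have hL0 : LL w n u = 0 := by
    unfold LL
    rw [mul_left_comm, PowerSeries.coeff_mul]
    apply Finset.sum_eq_zero
    intro p hp
    have hp := Finset.HasAntidiagonal.mem_antidiagonal.mp hp
    rw [coeff_th]
    rcases Nat.eq_zero_or_pos p.1 with h | h
    · simp [h]
    · rw [hu0 _ h (by omega)]; simp
  have hlin : ∀ x : ℂ, PowerSeries.constantCoeff (w - PowerSeries.C x * PowerSeries.X) = 1 := by
    intro x; simp [hw]
  have e1 : LL w n D + PowerSeries.coeff n (w ^ n) = 3 * LL w n e4 := by
    have := congrArg (LL w n) hwD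
    rw [LL_pow _ _ (by simp [h4]), LL_mul _ _ (by simp [hD]) (by simp [hw])] at this
    have h2 := LL_lin w hw n 0
    rw [map_zero, zero_mul, sub_zero, zero_pow (by omega), sub_zero] at h2
    rw [h2] at this
    exact_mod_cast this
  have e2 : 2 * LL w n e6 = LL w n D + PowerSeries.coeff n (w ^ n) - 1728 ^ n := by
    have := congrArg (LL w n) he6
    rw [LL_pow _ _ (by simp [h6]), LL_mul _ _ (by simp [hD]) (by simp [hw]), LL_lin w hw] at this
    push_cast at this
    rw [this]; ring
  have e3 : LL w n ek = α * LL w n e4 + β * LL w n e6 := by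
    rw [hek, LL_mul _ _ (by simp [h4]) (by simp [h6]), LL_pow _ _ (by simp [h4]),
      LL_pow _ _ (by simp [h6])]
  rw [hu, LL_mul, LL_mul, LL_pow, LL_prod, e3] at hL0
  · simp only [LL_lin w hw] at hL0
    rw [Multiset.sum_map_sub, Multiset.map_const', Multiset.sum_replicate, hR] at hL0
    rw [nsmul_eq_mul, Nat.cast_sub hm] at hL0
    linear_combination (-1 : ℂ) * hL0 + (ℓ : ℂ) * e1 + (β : ℂ) / 2 * e2 + (β : ℂ) / 2 * e1
  · simp [hw]
  · simp [hD]
  · simp [hD]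
  · simp [hek, h4, h6]
  · simp [hD, hek, h4, h6]
  · rw [map_multiset_prod]
    apply Multiset.prod_ne_zero
    simp [hw, Multiset.mem_replicate]

open scoped MatrixGroups in
lemma Eis_eq {k : ℕ} (hk : 3 ≤ k) (z : UpperHalfPlane) : Eis k z = ModularForm.E hk z := by
  rw [show ModularForm.E hk z = (1 / 2 : ℂ) • EisensteinSeries.eisensteinSeriesSIF (N := 1) 0 k z from rfl,
    EisensteinSeries.eisensteinSeriesSIF_apply 0 k z, eisensteinSeries]
  rw [Eis, if_neg (by omega), smul_eq_mul]
  congr 1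
  rw [← (finTwoArrowEquiv ℤ).tsum_eq, tsum_subtype _ (fun v => EisensteinSeries.eisSummand k v z)]
  apply tsum_congr
  intro v
  have : v ∈ EisensteinSeries.gammaSet 1 1 0 ↔ Int.gcd (v 0) (v 1) = 1 := by
    simp [EisensteinSeries.gammaSet]
    intro _ 
    exact Subsingleton.elim _ _
  classical
  rw [Set.indicator_apply, if_congr this rfl rfl]
  simp [EisensteinSeries.eisSummand]

lemma Disc_eq (z : UpperHalfPlane) : Disc z = ModularForm.discriminant z := by
  rw [ModularForm.discriminant_eq_q_prod, Disc]
  simp [qexp, ModularForm.eta_q, Function.Periodic.qParam, ← Complex.exp_nat_mul]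

open UpperHalfPlane ModularForm MatrixGroups EisensteinSeries in
lemma eq_E_of {k : ℕ} (hk : 3 ≤ k) (hk2 : Even k) (hr : Module.rank ℂ (ModularForm 𝒮ℒ (k:ℤ)) = 1)
    (f : ModularForm 𝒮ℒ (k : ℤ)) (h0 : PowerSeries.constantCoeff (qExpansion 1 f) = 1) :
    E hk = f := by
  obtain ⟨c, hc⟩ := (finrank_eq_one_iff_of_nonzero' (E hk) (E_ne_zero _ hk2)).mp
      (Module.rank_eq_one_iff_finrank_eq_one.mp hr) f
  have h1 := E_qExpansion_coeff_zero hk hk2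
  have h2 : qExpansion 1 f = c • qExpansion 1 (E hk) := by
    rw [← hc]
    exact ModularForm.qExpansion_smul one_pos one_mem_strictPeriods_SL c (E hk)
  rw [h2] at h0
  simp at h1
  simp [h1] at h0
  rw [← hc, h0, one_smul]

open UpperHalfPlane ModularForm MatrixGroups EisensteinSeries in
lemma E_prod (k α β : ℕ) (hk : k = 4 * α + 6 * β) (hk3 : 3 ≤ k) (hk14 : k < 12 ∨ k = 14)
    (z : ℍ) : E hk3 z = E₄ z ^ α * E₆ z ^ β := by
  have hk2 : Even k := ⟨2 * α + 3 * β, by omega⟩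
  have hr : Module.rank ℂ (ModularForm 𝒮ℒ (k:ℤ)) = 1 := by
    rw [dimension_level_one k hk2]
    rcases hk14 with h | h
    · rw [if_neg]
      · simp [Nat.div_eq_of_lt h]
      · intro h'
        have : k % 12 = 2 := h'
        omega
    · subst h
      rw [if_pos (by decide)]
      norm_num
  let g : ModularForm 𝒮ℒ (k : ℤ) := ModularForm.mcast (by rw [hk]; push_cast; ring) ((E₄.pow α).mul (E₆.pow β))
  have hg : ∀ z, g z = E₄ z ^ α * E₆ z ^ β := by
    intro z
    simp [g]
  rw [← hg]
  refine DFunLike.congr_fun (eq_E_of hk3 hk2 hr g ?_) z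
  have h4 := E_qExpansion_coeff_zero (k := 4) (by norm_num) ⟨2, rfl⟩
  have h6 := E_qExpansion_coeff_zero (k := 6) (by norm_num) ⟨3, rfl⟩
  simp at h4 h6
  have : qExpansion 1 g = (qExpansion 1 E₄) ^ α * (qExpansion 1 E₆) ^ β := by
    simp only [g, coe_mcast]
    rw [ModularForm.qExpansion_mul one_pos one_mem_strictPeriods_SL,
      ModularForm.qExpansion_pow one_pos one_mem_strictPeriods_SL,
      ModularForm.qExpansion_pow one_pos one_mem_strictPeriods_SL]
  rw [this]
  simp [h4, h6]

/-- Holomorphic, 1-periodic functions on the upper half plane, bounded at infinity. -/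
structure Good (F : ℂ → ℂ) : Prop where
  diff : ∀ z : ℂ, 0 < z.im → DifferentiableAt ℂ F z
  per : ∀ z : ℂ, 0 < z.im → F (z + 1) = F z
  bdd : UpperHalfPlane.IsBoundedAtImInfty (fun τ : UpperHalfPlane => F τ)

/-- The `q`-expansion. -/
def QQ (F : ℂ → ℂ) : PowerSeries ℂ := UpperHalfPlane.qExpansion 1 (fun τ : UpperHalfPlane => F τ)

lemma QQ_congr {F G : ℂ → ℂ} (h : ∀ z : ℂ, 0 < z.im → F z = G z) : QQ F = QQ G := by
  unfold QQ
  congr 1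
  funext τ
  exact h τ τ.im_pos

section
open UpperHalfPlane hiding I
open scoped Manifold

lemma per_of {F : ℂ → ℂ} (per : ∀ z : ℂ, 0 < z.im → F (z + 1) = F z) :
    Function.Periodic ((fun τ : ℍ => F τ) ∘ ofComplex) ((1 : ℝ) : ℂ) := by
  intro w
  by_cases hw : 0 < w.im
  · have h2 : 0 < (w + ((1 : ℝ) : ℂ)).im := by simpa using hw
    simp only [Function.comp, ofComplex_apply_of_im_pos hw, ofComplex_apply_of_im_pos h2]
    simpa using per w hw
  · have h2 : (w + ((1 : ℝ) : ℂ)).im ≤ 0 := by simpa using hw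
    simp only [Function.comp, ofComplex_apply_of_im_nonpos (not_lt.mp hw),
      ofComplex_apply_of_im_nonpos h2]

lemma mdiff_of {F : ℂ → ℂ} (diff : ∀ z : ℂ, 0 < z.im → DifferentiableAt ℂ F z) :
    MDiff (fun τ : ℍ => F τ) := by
  rw [UpperHalfPlane.mdifferentiable_iff]
  intro z hz
  refine (diff z hz).differentiableWithinAt.congr ?_ ?_
  · intro y hy
    simp [Function.comp, ofComplex_apply_of_im_pos hy]
  · simp [Function.comp, ofComplex_apply_of_im_pos hz]

lemma Good.an {F : ℂ → ℂ} (h : Good F) :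
    AnalyticAt ℂ (cuspFunction 1 (fun τ : ℍ => F τ)) 0 :=
  analyticAt_cuspFunction_zero one_pos (per_of h.per) (mdiff_of h.diff) h.bdd

lemma Good.mul {F G : ℂ → ℂ} (hF : Good F) (hG : Good G) : Good (fun z => F z * G z) where
  diff z hz := (hF.diff z hz).mul (hG.diff z hz)
  per z hz := by rw [hF.per z hz, hG.per z hz]
  bdd := hF.bdd.mul hG.bdd

lemma Good.add {F G : ℂ → ℂ} (hF : Good F) (hG : Good G) : Good (fun z => F z + G z) where
  diff z hz := (hF.diff z hz).add (hG.diff z hz)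
  per z hz := by rw [hF.per z hz, hG.per z hz]
  bdd := hF.bdd.add hG.bdd

lemma Good.congr {F G : ℂ → ℂ} (hF : Good F) (h : ∀ z : ℂ, 0 < z.im → F z = G z) : Good G where
  diff z hz := by
    refine (hF.diff z hz).congr_of_eventuallyEq ?_
    filter_upwards [(isOpen_upperHalfPlaneSet).mem_nhds hz] with y hy
    exact (h y hy).symm
  per z hz := by rw [← h z hz, ← h (z + 1) (by simpa using hz), hF.per z hz]
  bdd := by
    have : (fun τ : ℍ => G τ) = (fun τ : ℍ => F τ) := by
      funext τ; exact (h τ τ.im_pos).symm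
    rw [this]; exact hF.bdd

lemma QQ_mul {F G : ℂ → ℂ} (hF : Good F) (hG : Good G) :
    QQ (fun z => F z * G z) = QQ F * QQ G :=
  UpperHalfPlane.qExpansion_mul hF.an hG.an

lemma QQ_add {F G : ℂ → ℂ} (hF : Good F) (hG : Good G) :
    QQ (fun z => F z + G z) = QQ F + QQ G :=
  UpperHalfPlane.qExpansion_add hF.an hG.an

lemma Good.hasSum {F : ℂ → ℂ} (h : Good F) (τ : ℍ) :
    HasSum (fun m : ℕ => PowerSeries.coeff m (QQ F) * qexp τ ^ m) (F τ) := by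
  have := hasSum_qExpansion one_pos (per_of h.per) (mdiff_of h.diff) h.bdd τ
  simpa [Function.Periodic.qParam, qexp, QQ] using this

lemma good_of_hasSum {F : ℂ → ℂ} (diff : ∀ z : ℂ, 0 < z.im → DifferentiableAt ℂ F z)
    (c : ℕ → ℂ) (hc : ∀ z : ℂ, 0 < z.im → HasSum (fun m : ℕ => c m * qexp z ^ m) (F z)) :
    Good F ∧ QQ F = PowerSeries.mk c := by
  have hc' : ∀ τ : ℍ, HasSum (fun m : ℕ => c m • Function.Periodic.qParam 1 τ ^ m) (F τ) := by
    intro τ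
    simpa [Function.Periodic.qParam, qexp] using hc τ τ.im_pos
  have hg : Good F := by
    refine ⟨diff, ?_, isBoundedAtImInfty_of_hasSum_qExpansion one_pos hc'⟩
    intro z hz
    have h1 := hc z hz
    have h2 := hc (z + 1) (by simpa using hz)
    have : qexp (z + 1) = qexp z := by
      unfold qexp
      rw [mul_add, mul_one, Complex.exp_periodic]
    rw [this] at h2
    exact h2.unique h1
  refine ⟨hg, ?_⟩
  ext m
  rw [PowerSeries.coeff_mk]
  have hs : ∀ τ : ℍ, HasSum (fun m : ℕ => PowerSeries.coeff m (QQ F) •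
      Function.Periodic.qParam 1 τ ^ m) (F τ) := by
    intro τ
    simpa [Function.Periodic.qParam, qexp] using hg.hasSum τ
  have h1 := (hasFPowerSeriesOnBall_cuspFunction one_pos hg.an hc').hasFPowerSeriesAt
  have h2 := (hasFPowerSeriesOnBall_cuspFunction one_pos hg.an hs).hasFPowerSeriesAt
  simpa using congr_arg (FormalMultilinearSeries.coeff · m) (h2.eq_formalMultilinearSeries h1)

lemma good_const (a : ℂ) : Good (fun _ => a) ∧ QQ (fun _ => a) = PowerSeries.C a := by
  have := good_of_hasSum (F := fun _ => a) (fun z _ => differentiableAt_const _)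
    (fun m => if m = 0 then a else 0) (by
      intro z hz
      convert! hasSum_ite_eq (0 : ℕ) a using 2 with m
      split_ifs with h <;> simp [h])
  refine ⟨this.1, this.2.trans ?_⟩
  ext m
  simp [PowerSeries.coeff_C]

lemma good_qexp : Good qexp ∧ QQ qexp = PowerSeries.X := by
  have := good_of_hasSum (F := qexp) (fun z _ => by unfold qexp; fun_prop)
    (fun m => if m = 1 then 1 else 0) (by
      intro z hz
      convert! hasSum_ite_eq (1 : ℕ) (qexp z) using 2 with m
      split_ifs with h <;> simp [h])
  refine ⟨this.1, this.2.trans ?_⟩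
  ext m
  simp [PowerSeries.coeff_X]

lemma good_pow {F : ℂ → ℂ} (hF : Good F) (n : ℕ) :
    Good (fun z => F z ^ n) ∧ QQ (fun z => F z ^ n) = QQ F ^ n := by
  induction n with
  | zero => simpa using good_const 1
  | succ n ih =>
    simp only [pow_succ]
    exact ⟨ih.1.mul hF, by rw [QQ_mul ih.1 hF, ih.2]⟩

lemma good_prod (s : Multiset ℂ) (F : ℂ → ℂ → ℂ) (hF : ∀ x, Good (F x)) :
    Good (fun z => (s.map fun x => F x z).prod) ∧
      QQ (fun z => (s.map fun x => F x z).prod) = (s.map fun x => QQ (F x)).prod := by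
  induction s using Multiset.induction_on with
  | empty => simpa using good_const 1
  | cons a s ih =>
    simp only [Multiset.map_cons, Multiset.prod_cons]
    exact ⟨(hF a).mul ih.1, by rw [QQ_mul (hF a) ih.1, ih.2]⟩

lemma Good.coeff_eq {F : ℂ → ℂ} (h : Good F) (n : ℕ) :
    PowerSeries.coeff n (QQ F) =
      ∫ x in (0:ℝ)..1, F (x + Complex.I) / qexp (x + Complex.I) ^ n := by
  have := qExpansion_coeff_eq_intervalIntegral one_pos (per_of h.per) (mdiff_of h.diff) h.bdd n
    one_pos
  rw [QQ, this]
  simp [Function.Periodic.qParam, qexp, div_eq_mul_inv, mul_comm]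

lemma Good.deriv {F : ℂ → ℂ} (h : Good F) :
    Good (fun z => (2 * π * I)⁻¹ * deriv F z) ∧
      QQ (fun z => (2 * π * I)⁻¹ * deriv F z) = th (QQ F) := by
  set c := cuspFunction 1 (fun τ : ℍ => F τ) with hcdef
  have hd : DifferentiableOn ℂ c (Metric.ball 0 1) :=
    differentiableOn_cuspFunction_ball one_pos (per_of h.per) (mdiff_of h.diff) h.bdd
  have hq : ∀ z : ℂ, 0 < z.im → qexp z ∈ Metric.ball (0 : ℂ) 1 := by
    intro z hz
    have := Function.Periodic.norm_qParam_lt_one (h := 1) one_pos hz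
    simpa [Function.Periodic.qParam, qexp] using this
  have hFc : ∀ z : ℂ, 0 < z.im → F z = c (qexp z) := by
    intro z hz
    have := eq_cuspFunction ⟨z, hz⟩ one_ne_zero (per_of h.per)
    simpa [Function.Periodic.qParam, qexp] using this.symm
  have hder : ∀ z : ℂ, 0 < z.im → (2 * π * I)⁻¹ * _root_.deriv F z
      = qexp z * _root_.deriv c (qexp z) := by
    intro z hz
    have h1 : HasDerivAt qexp (qexp z * (2 * π * I)) z := by
      unfold qexp
      simpa using ((hasDerivAt_id z).const_mul (2 * π * I)).cexp
    have h2 := ((hd.differentiableAt (Metric.isOpen_ball.mem_nhds (hq z hz))).hasDerivAt).comp z h1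
    have h3 : F =ᶠ[𝓝 z] c ∘ qexp := by
      filter_upwards [(isOpen_upperHalfPlaneSet).mem_nhds hz] with y hy
      exact hFc y hy
    rw [h3.deriv_eq, h2.deriv]
    have := Complex.two_pi_I_ne_zero
    field_simp
  have := good_of_hasSum (F := fun z => (2 * π * I)⁻¹ * _root_.deriv F z) (by
      intro z hz
      have hdo : DifferentiableOn ℂ F upperHalfPlaneSet :=
        fun y hy => (h.diff y hy).differentiableWithinAt
      exact ((hdo.deriv isOpen_upperHalfPlaneSet).differentiableAt
        (isOpen_upperHalfPlaneSet.mem_nhds hz)).const_mul _)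
    (fun m => PowerSeries.coeff m (th (QQ F))) (by
      intro z hz
      have hs := Complex.hasSum_taylorSeries_on_ball (hd.deriv Metric.isOpen_ball) (hq z hz)
      rw [hder z hz]
      rw [← hasSum_nat_add_iff' 1]
      simp only [Finset.range_one, Finset.sum_singleton, coeff_th]
      simp only [Nat.cast_zero, zero_mul, sub_zero]
      refine (hs.mul_left (qexp z)).congr_fun ?_
      intro m
      rw [QQ, qExpansion_coeff, ← hcdef, iteratedDeriv_succ', Nat.factorial_succ]
      have : (m.factorial : ℂ) ≠ 0 := by exact_mod_cast m.factorial_ne_zero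
      have h2 : ((m + 1 : ℕ) : ℂ) ≠ 0 := Nat.cast_ne_zero.mpr (Nat.succ_ne_zero m)
      push_cast at *
      simp only [smul_eq_mul, sub_zero]
      field_simp
      ring)
  refine ⟨this.1, this.2.trans ?_⟩
  ext m
  simp
end

section
open UpperHalfPlane hiding I
open scoped Manifold MatrixGroups

lemma good_modform {k : ℤ} (f : ModularForm 𝒮ℒ k) (F : ℂ → ℂ) (hF : ∀ τ : ℍ, F τ = f τ) :
    Good F ∧ QQ F = qExpansion 1 f := by
  have hfun : (fun τ : ℍ => F τ) = f := funext hF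
  refine ⟨⟨?_, ?_, ?_⟩, ?_⟩
  · intro z hz
    have h := (UpperHalfPlane.mdifferentiable_iff.mp f.holo') z hz
    have h2 := h.differentiableAt (isOpen_upperHalfPlaneSet.mem_nhds hz)
    refine h2.congr_of_eventuallyEq ?_
    filter_upwards [(isOpen_upperHalfPlaneSet).mem_nhds hz] with y hy
    simp only [Function.comp, ofComplex_apply_of_im_pos hy]
    exact hF ⟨y, hy⟩
  · intro z hz
    have h := SlashInvariantFormClass.periodic_comp_ofComplex (Γ := 𝒮ℒ) (k := k) (h := 1) f (by simp) z
    have h2 : 0 < (z + ((1 : ℝ) : ℂ)).im := by simpa using hz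
    simp only [Function.comp, ofComplex_apply_of_im_pos hz, ofComplex_apply_of_im_pos h2] at h
    have e1 := hF ⟨_, hz⟩
    have e2 := hF ⟨_, h2⟩
    simp only at e1 e2
    rw [← e1, ← e2] at h
    simpa using h
  · rw [hfun]
    exact ModularFormClass.bdd_at_infty f
  · rw [QQ, hfun]

lemma S_modform {k : ℕ} (f : ModularForm 𝒮ℒ (k : ℤ)) (F : ℂ → ℂ) (hF : ∀ τ : ℍ, F τ = f τ) 
    (z : ℂ) (hz : 0 < z.im) : F (-1 / z) = z ^ k * F z := by
  have h := SlashInvariantForm.slash_action_eqn' f (Γ := 𝒮ℒ) (k := k)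
    (γ := Matrix.SpecialLinearGroup.mapGL ℝ ModularGroup.S) ⟨_, rfl⟩ ⟨z, hz⟩
  have hS : (Matrix.SpecialLinearGroup.mapGL ℝ ModularGroup.S) • (⟨z, hz⟩ : ℍ) = ModularGroup.S • ⟨z, hz⟩ := rfl
  rw [hS] at h
  rw [UpperHalfPlane.modular_S_smul] at h
  have e1 := hF ⟨_, hz⟩
  rw [← hF, ← hF] at h
  have a1 : (Matrix.SpecialLinearGroup.mapGL ℝ ModularGroup.S) 1 0 = 1 := by
    rw [Matrix.SpecialLinearGroup.mapGL_coe_matrix, Matrix.SpecialLinearGroup.map_apply_coe]; simp [ModularGroup.S]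
  have a2 : (Matrix.SpecialLinearGroup.mapGL ℝ ModularGroup.S) 1 1 = 0 := by
    rw [Matrix.SpecialLinearGroup.mapGL_coe_matrix, Matrix.SpecialLinearGroup.map_apply_coe]; simp [ModularGroup.S]
  rw [a1, a2] at h
  simpa [neg_div] using h

lemma good_E (k : ℕ) (hk : 3 ≤ k) : Good (Eis k) ∧ QQ (Eis k) = qExpansion 1 (ModularForm.E hk) :=
  good_modform _ _ (Eis_eq hk)

lemma Eis_S (k : ℕ) (hk : 3 ≤ k) (z : ℂ) (hz : 0 < z.im) : Eis k (-1 / z) = z ^ k * Eis k z :=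
  S_modform (ModularForm.E hk) _ (Eis_eq hk) z hz

lemma Disc_E (z : ℂ) (hz : 0 < z.im) : 1728 * Disc z = Eis 4 z ^ 3 - Eis 6 z ^ 2 := by
  have h := ModularForm.discriminant_eq_E₄_cube_sub_E₆_sq ⟨z, hz⟩
  have h1 := Disc_eq ⟨z, hz⟩
  have h4 := Eis_eq (k := 4) (by norm_num) ⟨z, hz⟩
  have h6 := Eis_eq (k := 6) (by norm_num) ⟨z, hz⟩
  simp only at h1 h4 h6
  rw [h1, h4, h6]
  have h' : ModularForm.discriminant ⟨z, hz⟩ = (ModularForm.E₄ ⟨z, hz⟩ ^ 3 - ModularForm.E₆ ⟨z, hz⟩ ^ 2) / 1728 := h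
  rw [h']; ring

lemma Disc_S (z : ℂ) (hz : 0 < z.im) : Disc (-1 / z) = z ^ 12 * Disc z := by
  have hz2 : 0 < (-1 / z).im := by
    rw [neg_div, one_div, Complex.neg_im, Complex.inv_im]
    have : 0 < normSq z := Complex.normSq_pos.mpr (by rintro rfl; simp at hz)
    rw [neg_div, neg_neg]; positivity
  have h1 := Disc_E z hz
  have h2 := Disc_E _ hz2
  rw [Eis_S 4 (by norm_num) z hz, Eis_S 6 (by norm_num) z hz] at h2
  linear_combination (1/1728) * h2 - z^12 / 1728 * h1

lemma Disc_ne (z : ℂ) (hz : 0 < z.im) : Disc z ≠ 0 := by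
  have h1 := Disc_eq ⟨z, hz⟩
  simp only at h1
  rw [h1]
  exact ModularForm.discriminant_ne_zero _

lemma qexp_ne (z : ℂ) : qexp z ≠ 0 := Complex.exp_ne_zero _

lemma qexp_per (z : ℂ) : qexp (z + 1) = qexp z := by
  unfold qexp
  rw [mul_add, mul_one, Complex.exp_periodic]

/-- `Δ / q`. -/
def Df (z : ℂ) : ℂ := ∏' n : ℕ, (1 - qexp z ^ (n + 1)) ^ 24

lemma Disc_Df (z : ℂ) : Disc z = qexp z * Df z := rfl

lemma Df_ne (z : ℂ) (hz : 0 < z.im) : Df z ≠ 0 := by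
  have := Disc_ne z hz
  rw [Disc_Df] at this
  exact right_ne_zero_of_mul this

lemma Disc_diff (z : ℂ) (hz : 0 < z.im) : DifferentiableAt ℂ Disc z := by
  have h : DifferentiableAt ℂ (fun z => (Eis 4 z ^ 3 - Eis 6 z ^ 2) / 1728) z := by
    exact ((((good_E 4 (by norm_num)).1.diff z hz).pow 3).sub
      (((good_E 6 (by norm_num)).1.diff z hz).pow 2)).div_const _
  refine h.congr_of_eventuallyEq ?_
  filter_upwards [(isOpen_upperHalfPlaneSet).mem_nhds hz] with y hy
  rw [← Disc_E y hy]; ring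

lemma Df_tendsto : Tendsto (fun τ : ℍ => Df τ) atImInfty (𝓝 1) := by
  have h : ∀ τ : ℍ, ∏' (n : ℕ), (1 - ModularForm.eta_q n τ) ^ 24 = Df τ := by
    intro τ
    unfold Df
    refine tprod_congr fun n => ?_
    rw [ModularForm.eta_q_eq_pow]
    simp only [qexp]
  exact Tendsto.congr h ModularForm.tendsto_atImInfty_tprod_one_sub_eta_q_pow

lemma Df_diff (z : ℂ) (hz : 0 < z.im) : DifferentiableAt ℂ Df z := by
  have h : DifferentiableAt ℂ (fun z => Disc z / qexp z) z :=
    (Disc_diff z hz).div (good_qexp.1.diff z hz) (qexp_ne z)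
  refine h.congr_of_eventuallyEq (Eventually.of_forall fun y => ?_)
  show Df y = Disc y / qexp y
  rw [Disc_Df, mul_div_cancel_left₀ _ (qexp_ne y)]

lemma Df_per (z : ℂ) : Df (z + 1) = Df z := by
  unfold Df
  rw [qexp_per]

lemma bdd_of_tendsto {F : ℂ → ℂ} {c : ℂ} (h : Tendsto (fun τ : ℍ => F τ) atImInfty (𝓝 c)) :
    IsBoundedAtImInfty (fun τ : ℍ => F τ) :=
  h.isBigO_one ℝ

lemma good_Df : Good Df := ⟨Df_diff, fun z _ => Df_per z, bdd_of_tendsto Df_tendsto⟩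

lemma good_Dinv : Good (fun z => (Df z)⁻¹) := by
  refine ⟨fun z hz => (Df_diff z hz).inv (Df_ne z hz), fun z _ => by rw [Df_per], ?_⟩
  exact bdd_of_tendsto (F := fun z => (Df z)⁻¹) (c := 1⁻¹) (Df_tendsto.inv₀ one_ne_zero)

lemma Good.const_coeff {F : ℂ → ℂ} (h : Good F) {c : ℂ}
    (hc : Tendsto (fun τ : ℍ => F τ) atImInfty (𝓝 c)) : PowerSeries.constantCoeff (QQ F) = c := by
  rw [← PowerSeries.coeff_zero_eq_constantCoeff_apply, QQ,
    UpperHalfPlane.qExpansion_coeff_zero one_pos h.an (per_of h.per)]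
  exact hc.limUnder_eq

lemma QQ_Dinv : QQ Df * QQ (fun z => (Df z)⁻¹) = 1 := by
  rw [← QQ_mul good_Df good_Dinv]
  rw [QQ_congr (G := fun _ => 1) fun z hz => mul_inv_cancel₀ (Df_ne z hz), (good_const 1).2]
  simp

lemma const_E (k : ℕ) (hk : 3 ≤ k) (hk2 : Even k) : PowerSeries.constantCoeff (QQ (Eis k)) = 1 := by
  rw [(good_E k hk).2, ← PowerSeries.coeff_zero_eq_constantCoeff_apply]
  exact EisensteinSeries.E_qExpansion_coeff_zero hk hk2

lemma const_D : PowerSeries.constantCoeff (QQ Df) = 1 := good_Df.const_coeff Df_tendsto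

/-- `q j`. -/
def wf (z : ℂ) : ℂ := Eis 4 z ^ 3 * (Df z)⁻¹

lemma good_wf : Good wf := (good_pow (good_E 4 (by norm_num)).1 3).1.mul good_Dinv

lemma QQ_wf : QQ Df * QQ wf = QQ (Eis 4) ^ 3 := by
  have : QQ wf = QQ (Eis 4) ^ 3 * QQ (fun z => (Df z)⁻¹) := by
    rw [← (good_pow (good_E 4 (by norm_num)).1 3).2]
    exact QQ_mul (good_pow (good_E 4 (by norm_num)).1 3).1 good_Dinv
  rw [this]
  linear_combination QQ (Eis 4) ^ 3 * QQ_Dinv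

lemma const_w : PowerSeries.constantCoeff (QQ wf) = 1 := by
  have := congrArg PowerSeries.constantCoeff QQ_wf
  simpa [const_D, const_E 4 (by norm_num) (by decide)] using this

lemma QQ_E6 : QQ (Eis 6) ^ 2 = QQ (Eis 4) ^ 3 - PowerSeries.C 1728 * PowerSeries.X * QQ Df := by
  have h1 := (good_pow (good_E 4 (by norm_num)).1 3)
  have h2 := (good_pow (good_E 6 (by norm_num)).1 2)
  have h3 := good_const 1728
  have h4 := h3.1.mul (good_qexp.1.mul good_Df)
  have h5 : QQ (fun z => Eis 4 z ^ 3) = QQ (fun z => Eis 6 z ^ 2 + 1728 * (qexp z * Df z)) := by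
    refine QQ_congr fun z hz => ?_
    have := Disc_E z hz
    rw [Disc_Df] at this
    rw [this]; ring
  rw [QQ_add h2.1 h4, QQ_mul h3.1 (good_qexp.1.mul good_Df), QQ_mul good_qexp.1 good_Df, h1.2, h2.2,
    h3.2, good_qexp.2] at h5
  rw [h5]; ring

lemma jinv_wf (z : ℂ) (hz : 0 < z.im) : jinv z = wf z / qexp z := by
  have := Df_ne z hz
  have := qexp_ne z
  rw [jinv, wf, Disc_Df]
  field_simp

lemma cj_eq (n : ℕ) : cj n 0 = PowerSeries.coeff n (QQ wf ^ n) := by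
  rw [← (good_pow good_wf n).2, (good_pow good_wf n).1.coeff_eq n, cj, qCoeff]
  refine intervalIntegral.integral_congr fun x _ => ?_
  have : 0 < ((x : ℂ) + I).im := by simp
  simp only [jinv_wf _ this, div_pow]
  simp
end

section
open UpperHalfPlane hiding I

lemma mem_ball2 (z : ℂ) : z ∈ Metric.ball (2 * I) 2 ↔ normSq z < 4 * z.im := by
  rw [Metric.mem_ball, Complex.dist_eq, ← sq_lt_sq₀ (norm_nonneg _) (by norm_num), ← Complex.normSq_eq_norm_sq]
  simp only [normSq_apply, sub_re, sub_im, mul_re, mul_im, Complex.I_re, Complex.I_im, re_ofNat, im_ofNat]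
  constructor <;> intro h <;> nlinarith

lemma im_pos_of_mem {z : ℂ} (h : z ∈ Metric.ball (2 * I) 2) : 0 < z.im := by
  rw [mem_ball2] at h
  have := normSq_nonneg z
  linarith

lemma im_neg_inv {z : ℂ} (hz : 0 < z.im) : 0 < (-1 / z).im := by
  rw [neg_div, one_div, Complex.neg_im, Complex.inv_im]
  have : 0 < normSq z := Complex.normSq_pos.mpr (by rintro rfl; simp at hz)
  rw [neg_div, neg_neg]; positivity

lemma contour (g J : ℂ → ℂ) (hg : ∀ z : ℂ, 0 < z.im → DifferentiableAt ℂ g z)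
    (hper : ∀ z : ℂ, 0 < z.im → g (z + 1) = g z)
    (hJ : ∀ z : ℂ, 0 < z.im → ContinuousAt J z)
    (hS : ∀ z : ℂ, 0 < z.im → g (-1 / z) / z ^ 2 = g z + 4 * J z / z) :
    4 * I * ∫ θ in (π / 2)..(2 * π / 3), J (Complex.exp (θ * I)) =
      ∫ x in (0:ℝ)..1, g (x + I) := by
  obtain ⟨G, hG⟩ : Complex.IsExactOn g (Metric.ball (2 * I) 2) :=
    DifferentiableOn.isExactOn_ball fun z hz => (hg z (im_pos_of_mem hz)).differentiableWithinAt
  have hpi := Real.pi_pos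
  -- points on the arc
  have hexp_im : ∀ θ : ℝ, (Complex.exp (θ * I)).im = Real.sin θ := fun θ => by
    rw [Complex.exp_ofReal_mul_I_im]
  have hsin : ∀ θ : ℝ, θ ∈ Set.uIcc (π / 2) (2 * π / 3) → 1 / 4 < Real.sin θ := by
    intro θ hθ
    rw [Set.uIcc_of_le (by linarith)] at hθ
    have h1 : Real.sin θ = Real.cos (θ - π / 2) := by rw [Real.cos_sub_pi_div_two]
    have h2 : Real.cos (π / 3) ≤ Real.cos (θ - π / 2) := by
      apply Real.cos_le_cos_of_nonneg_of_le_pi <;> linarith [hθ.1, hθ.2]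
    rw [Real.cos_pi_div_three] at h2
    rw [h1]; linarith
  have hns : ∀ θ : ℝ, normSq (Complex.exp (θ * I)) = 1 := by
    intro θ
    rw [Complex.normSq_eq_norm_sq, Complex.norm_exp_ofReal_mul_I]; norm_num
  have hmem : ∀ θ : ℝ, θ ∈ Set.uIcc (π / 2) (2 * π / 3) →
      Complex.exp (θ * I) ∈ Metric.ball (2 * I) 2 := by
    intro θ hθ
    rw [mem_ball2, hns, hexp_im]
    linarith [hsin θ hθ]
  have hmem2 : ∀ θ : ℝ, θ ∈ Set.uIcc (π / 2) (2 * π / 3) →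
      -1 / Complex.exp (θ * I) ∈ Metric.ball (2 * I) 2 := by
    intro θ hθ
    rw [mem_ball2, neg_div, one_div, Complex.normSq_neg, Complex.normSq_inv, hns, Complex.neg_im,
      Complex.inv_im, hns, hexp_im]
    have := hsin θ hθ
    norm_num
    linarith
  have hder : ∀ θ ∈ Set.uIcc (π / 2) (2 * π / 3),
      HasDerivAt (fun θ : ℝ => G (-1 / Complex.exp (θ * I)) - G (Complex.exp (θ * I)))
        (4 * I * J (Complex.exp (θ * I))) θ := by
    intro θ hθ
    have hne := Complex.exp_ne_zero (θ * I)
    have he : HasDerivAt (fun θ : ℝ => Complex.exp (θ * I)) (Complex.exp (θ * I) * I) θ := by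
      simpa using ((hasDerivAt_id (θ : ℂ)).mul_const I).cexp.comp_ofReal
    have h1 := (hG _ (hmem θ hθ)).comp θ he
    have he2 : HasDerivAt (fun θ : ℝ => -1 / Complex.exp (θ * I))
        (I / Complex.exp (θ * I)) θ := by
      have := (hasDerivAt_const θ (-1 : ℂ)).div he hne
      refine this.congr_deriv ?_
      field_simp
      ring
    have h2 := (hG _ (hmem2 θ hθ)).comp θ he2
    refine (h2.sub h1).congr_deriv ?_
    have := hS _ (im_pos_of_mem (hmem θ hθ))
    have h3 : g (-1 / Complex.exp (θ * I)) = (g (Complex.exp (θ * I)) + 4 * J (Complex.exp (θ * I)) / Complex.exp (θ * I)) * Complex.exp (θ * I) ^ 2 := by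
      rw [← this]; field_simp
    rw [h3]
    field_simp
    ring
  have hint := intervalIntegral.integral_eq_sub_of_hasDerivAt hder (by
    apply ContinuousOn.intervalIntegrable
    intro θ hθ
    apply ContinuousAt.continuousWithinAt
    have := hJ _ (im_pos_of_mem (hmem θ hθ))
    have hc : ContinuousAt (fun θ : ℝ => Complex.exp (θ * I)) θ := by fun_prop
    exact continuousAt_const.mul (ContinuousAt.comp (f := fun θ : ℝ => Complex.exp (θ * I)) this hc))
  rw [intervalIntegral.integral_const_mul] at hint
  rw [hint]
  -- endpoints
  have e1 : Complex.exp (((π / 2 : ℝ) : ℂ) * I) = I := by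
    push_cast; exact Complex.exp_pi_div_two_mul_I
  have e2 : Complex.exp (((2 * π / 3 : ℝ) : ℂ) * I) = -(1 / 2) + (Real.sqrt 3 / 2 : ℝ) * I := by
    rw [Complex.exp_mul_I, ← Complex.ofReal_cos, ← Complex.ofReal_sin]
    have h : 2 * π / 3 = π - π / 3 := by ring
    rw [h, Real.cos_pi_sub, Real.sin_pi_sub, Real.cos_pi_div_three, Real.sin_pi_div_three]
    push_cast; ring
  have e3 : -1 / Complex.exp (((2 * π / 3 : ℝ) : ℂ) * I) = Complex.exp (((2 * π / 3 : ℝ) : ℂ) * I) + 1 := by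
    rw [div_eq_iff (Complex.exp_ne_zero _), e2]
    have h3 : ((Real.sqrt 3 : ℝ) : ℂ) ^ 2 = 3 := by
      rw [← Complex.ofReal_pow, Real.sq_sqrt (by norm_num)]; norm_num
    have hI := Complex.I_sq
    push_cast
    linear_combination (1/4) * (-3 : ℂ) * hI - (1/4) * I ^ 2 * h3
  rw [e3, e1]
  have e4 : -1 / I = I := by rw [div_eq_iff Complex.I_ne_zero]; simp
  rw [e4, sub_self, sub_zero]
  have hright : (π / 2) ≤ 2 * π / 3 := by linarith
  have hm0 := hmem _ (Set.right_mem_uIcc)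
  have hm1 := hmem2 _ (Set.right_mem_uIcc)
  rw [e3] at hm1
  set ρ := Complex.exp (((2 * π / 3 : ℝ) : ℂ) * I)
  -- translation
  set s : Set ℂ := Metric.ball (2 * I) 2 ∩ (fun z => 1 + z) ⁻¹' Metric.ball (2 * I) 2 with hs
  have hso : IsOpen s := Metric.isOpen_ball.inter (Metric.isOpen_ball.preimage (by fun_prop))
  have hsc : IsPreconnected s :=
    ((convex_ball _ _).inter ((convex_ball _ _).translate_preimage_right 1)).isPreconnected
  have hd : ∀ z ∈ s, HasDerivAt (fun z => G (1 + z) - G z) 0 z := by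
    intro z hz
    have h1 := (hG _ hz.2).comp z ((hasDerivAt_id z).const_add 1)
    refine (h1.sub (hG _ hz.1)).congr_deriv ?_
    have := hper z (im_pos_of_mem hz.1)
    rw [add_comm] at this
    simp [this]
  have hρ : ρ ∈ s := ⟨hm0, by simpa [add_comm] using hm1⟩
  have hI : I ∈ s := by
    refine ⟨?_, ?_⟩
    · rw [mem_ball2]; norm_num
    · show 1 + I ∈ Metric.ball (2 * I) 2
      rw [mem_ball2]; norm_num [normSq_apply]
  have hconst := hso.is_const_of_deriv_eq_zero hsc
    (fun z hz => (hd z hz).differentiableAt.differentiableWithinAt)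
    (fun z hz => (hd z hz).deriv) hρ hI
  rw [add_comm ρ 1, hconst]
  have hx : ∀ x ∈ Set.uIcc (0:ℝ) 1, (x : ℂ) + I ∈ Metric.ball (2 * I) 2 := by
    intro x hx
    rw [Set.uIcc_of_le zero_le_one] at hx
    rw [mem_ball2]; simp [normSq_apply]
    nlinarith [hx.1, hx.2]
  have hder2 : ∀ x ∈ Set.uIcc (0:ℝ) 1, HasDerivAt (fun x : ℝ => G (x + I)) (g (x + I)) x := by
    intro x hx'
    have he : HasDerivAt (fun x : ℝ => (x : ℂ) + I) 1 x := by
      simpa using ((hasDerivAt_id (x : ℂ)).add_const I).comp_ofReal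
    exact ((hG _ (hx x hx')).comp x he).congr_deriv (mul_one _)
  have hint2 := intervalIntegral.integral_eq_sub_of_hasDerivAt hder2 (by
    apply ContinuousOn.intervalIntegrable
    intro x hx'
    apply ContinuousAt.continuousWithinAt
    have hc : ContinuousAt (fun x : ℝ => (x : ℂ) + I) x := by fun_prop
    exact ContinuousAt.comp (f := fun x : ℝ => (x : ℂ) + I)
      (hg _ (im_pos_of_mem (hx x hx'))).continuousAt hc)
  rw [hint2]; simp

lemma Acoef_eq (n : ℕ) (hn : 1 ≤ n) : Acoef n = LL (QQ wf) n (QQ (Eis 4)) / 4 := by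
  obtain ⟨N, rfl⟩ : ∃ N, n = N + 1 := ⟨n - 1, by omega⟩
  have g4 := (good_E 4 (by norm_num)).1
  have hdd : ∀ z : ℂ, 0 < z.im → DifferentiableAt ℂ (deriv (Eis 4)) z := by
    intro z hz
    have hdo : DifferentiableOn ℂ (Eis 4) upperHalfPlaneSet :=
        fun y hy => (g4.diff y hy).differentiableWithinAt
    exact (hdo.deriv isOpen_upperHalfPlaneSet).differentiableAt
        (isOpen_upperHalfPlaneSet.mem_nhds hz)
  have hdper : ∀ z : ℂ, 0 < z.im → deriv (Eis 4) (z + 1) = deriv (Eis 4) z := by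
    intro z hz
    have := g4.deriv.1.per z hz
    simpa using this
  have hDper : ∀ z : ℂ, Disc (z + 1) = Disc z := by
    intro z; rw [Disc_Df, Disc_Df, qexp_per, Df_per]
  have hc := contour (fun z => Eis 4 z ^ (3 * N + 2) * deriv (Eis 4) z / Disc z ^ (N + 1))
    (fun z => jinv z ^ (N + 1))
    (fun z hz => (((g4.diff z hz).pow _).mul (hdd z hz)).div ((Disc_diff z hz).pow _)
      (pow_ne_zero _ (Disc_ne z hz)))
    (fun z hz => by simp only [g4.per z hz, hdper z hz, hDper])
    (fun z hz => ((((g4.diff z hz).pow 3).div (Disc_diff z hz) (Disc_ne z hz)).pow _).continuousAt)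
    (fun z hz => by
      have hz0 : z ≠ 0 := by rintro rfl; simp at hz
      have hD := Disc_ne z hz
      have h1 : HasDerivAt (fun z : ℂ => -1 / z) (1 / z ^ 2) z := by
        have := (hasDerivAt_const z (-1 : ℂ)).div (hasDerivAt_id z) hz0
        refine this.congr_deriv ?_
        simp
      have h2 := (g4.diff _ (im_neg_inv hz)).hasDerivAt.comp z h1
      have h3 : HasDerivAt (fun z => z ^ 4 * Eis 4 z) (4 * z ^ 3 * Eis 4 z + z ^ 4 * deriv (Eis 4) z) z := by
        have := (hasDerivAt_pow 4 z).mul (g4.diff z hz).hasDerivAt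
        exact this.congr_deriv (by norm_num)
      have h4 : (Eis 4 ∘ fun z : ℂ => -1 / z) =ᶠ[𝓝 z] (fun z => z ^ 4 * Eis 4 z) := by
        filter_upwards [(isOpen_upperHalfPlaneSet).mem_nhds hz] with y hy
        exact Eis_S 4 (by norm_num) y hy
      have h5 := h2.unique (h3.congr_of_eventuallyEq h4)
      have h6 : deriv (Eis 4) (-1 / z) = (4 * z ^ 3 * Eis 4 z + z ^ 4 * deriv (Eis 4) z) * z ^ 2 := by
        rw [← h5]; field_simp
      rw [h6, Eis_S 4 (by norm_num) z hz, Disc_S z hz, jinv]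
      have hDn := pow_ne_zero (N + 1) hD
      simp only [mul_pow, div_pow]
      field_simp
      ring)
  have hth := g4.deriv
  have gg := ((good_pow g4 (3 * N + 2)).1.mul hth.1).mul (good_pow good_Dinv (N + 1)).1
  have hco := gg.coeff_eq (N + 1)
  have hQ : QQ (fun z => Eis 4 z ^ (3 * N + 2) * ((2 * π * I)⁻¹ * deriv (Eis 4) z) * (Df z)⁻¹ ^ (N + 1))
      = QQ wf ^ (N + 1) * th (QQ (Eis 4)) * (QQ (Eis 4))⁻¹ := by
    rw [PowerSeries.eq_mul_inv_iff_mul_eq (by rw [const_E 4 (by norm_num) (by decide)]; exact one_ne_zero),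
      ← QQ_mul gg g4, ← hth.2, ← (good_pow good_wf (N + 1)).2,
      ← QQ_mul (good_pow good_wf (N + 1)).1 hth.1]
    refine QQ_congr fun z hz => ?_
    rw [wf]; ring
  rw [hQ, mul_assoc] at hco
  rw [LL, hco, Acoef]
  have hp := Complex.two_pi_I_ne_zero
  have hp2 : (π : ℂ) ≠ 0 := by exact_mod_cast Real.pi_ne_zero
  have hcon : (∫ x in (0:ℝ)..1, Eis 4 (x + I) ^ (3 * N + 2) * ((2 * π * I)⁻¹ * deriv (Eis 4) (x + I))
      * (Df (x + I))⁻¹ ^ (N + 1) / qexp (x + I) ^ (N + 1)) = (2 * π * I)⁻¹ *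
      ∫ x in (0:ℝ)..1, Eis 4 (x + I) ^ (3 * N + 2) * deriv (Eis 4) (x + I) / Disc (x + I) ^ (N + 1) := by
    rw [← intervalIntegral.integral_const_mul]
    refine intervalIntegral.integral_congr fun x _ => ?_
    simp only [Disc_Df, mul_pow, inv_pow, div_eq_mul_inv, mul_inv]
    ring
  rw [hcon, ← hc]
  have := Complex.I_ne_zero
  generalize (∫ θ in (π / 2)..(2 * π / 3), jinv (Complex.exp (θ * I)) ^ (N + 1)) = y
  field_simp
end

section
open ArithmeticFunction

/-- The integral series `∑ σ_k(m) q^m`. -/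
def Sg (k : ℕ) : PowerSeries ℤ := PowerSeries.mk fun m => ((sigma k m : ℕ) : ℤ)

lemma QQ_E_int (k : ℕ) (hk : 3 ≤ k) (hk2 : Even k) (c : ℤ)
    (hc : -(2 * k / _root_.bernoulli k : ℂ) = c) :
    QQ (Eis k) = (1 + PowerSeries.C c * Sg (k - 1)).map (Int.castRingHom ℂ) := by
  rw [(good_E k hk).2]
  ext m
  rw [EisensteinSeries.E_qExpansion_coeff hk hk2, hc]
  simp only [PowerSeries.coeff_map, map_add, PowerSeries.coeff_C_mul, PowerSeries.coeff_one, Sg,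
    PowerSeries.coeff_mk]
  split_ifs with h
  · subst h; simp
  · simp

lemma bern4 : _root_.bernoulli 4 = -1 / 30 := by decide +kernel
lemma bern6 : _root_.bernoulli 6 = 1 / 42 := by decide +kernel

lemma Q4_int : QQ (Eis 4) = (1 + PowerSeries.C 240 * Sg 3).map (Int.castRingHom ℂ) :=
  QQ_E_int 4 (by norm_num) (by decide) 240 (by rw [bern4]; norm_num)

lemma Q6_int : QQ (Eis 6) = (1 + PowerSeries.C (-504) * Sg 5).map (Int.castRingHom ℂ) :=
  QQ_E_int 6 (by norm_num) (by decide) (-504) (by rw [bern6]; norm_num)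

lemma dvd12 (d : ℤ) : (12 : ℤ) ∣ 5 * d ^ 3 + 7 * d ^ 5 := by
  have h : ∀ x : ZMod 12, 5 * x ^ 3 + 7 * x ^ 5 = 0 := by decide
  have := h (d : ZMod 12)
  have h2 := (ZMod.intCast_zmod_eq_zero_iff_dvd (5 * d ^ 3 + 7 * d ^ 5) 12).mp (by push_cast; exact this)
  exact_mod_cast h2

lemma Sg_dvd : ∃ T : PowerSeries ℤ, PowerSeries.C 5 * Sg 3 + PowerSeries.C 7 * Sg 5 = PowerSeries.C 12 * T := by
  have h : ∀ m : ℕ, (12 : ℤ) ∣ 5 * ((sigma 3 m : ℕ) : ℤ) + 7 * ((sigma 5 m : ℕ) : ℤ) := by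
    intro m
    simp only [sigma_apply]
    push_cast
    rw [Finset.mul_sum, Finset.mul_sum, ← Finset.sum_add_distrib]
    exact Finset.dvd_sum fun d _ => dvd12 d
  choose t ht using h
  refine ⟨PowerSeries.mk t, ?_⟩
  ext m
  simp only [Sg, map_add, PowerSeries.coeff_C_mul, PowerSeries.coeff_mk]
  exact ht m

lemma Dinv_int : ∃ P : PowerSeries ℤ, QQ Df * P.map (Int.castRingHom ℂ) = 1 := by
  obtain ⟨T, hT⟩ := Sg_dvd
  set V : PowerSeries ℤ := T + 100 * Sg 3 ^ 2 + 8000 * Sg 3 ^ 3 - 147 * Sg 5 ^ 2 with hV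
  have e5 : (PowerSeries.C 5 : PowerSeries ℤ) = 5 := map_ofNat _ 5
  have e7 : (PowerSeries.C 7 : PowerSeries ℤ) = 7 := map_ofNat _ 7
  have e12 : (PowerSeries.C 12 : PowerSeries ℤ) = 12 := map_ofNat _ 12
  have e240 : (PowerSeries.C 240 : PowerSeries ℤ) = 240 := map_ofNat _ 240
  have e504 : (PowerSeries.C (-504) : PowerSeries ℤ) = -504 := by rw [map_neg]; congr 1
  have e1728 : (PowerSeries.C 1728 : PowerSeries ℂ) = 1728 := map_ofNat _ 1728
  rw [e5, e7, e12] at hT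
  have h1 : (1 + PowerSeries.C 240 * Sg 3) ^ 3 - (1 + PowerSeries.C (-504) * Sg 5) ^ 2 = 1728 * V := by
    rw [e240, e504, hV]
    linear_combination 144 * hT
  have h2 : (1728 : PowerSeries ℂ) * (PowerSeries.X * QQ Df) = 1728 * V.map (Int.castRingHom ℂ) := by
    have h3 := congrArg (PowerSeries.map (Int.castRingHom ℂ)) h1
    rw [map_sub, map_pow, map_pow, ← Q4_int, ← Q6_int, map_mul, map_ofNat, QQ_E6, e1728] at h3
    rw [← h3]; ring
  have hne : (1728 : PowerSeries ℂ) ≠ 0 := by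
    rw [← e1728]; intro h
    have := congrArg PowerSeries.constantCoeff h
    norm_num at this
  have h3 := mul_left_cancel₀ hne h2
  have h4 : PowerSeries.constantCoeff V = 0 := by
    have := congrArg PowerSeries.constantCoeff h3
    simp at this
    rw [← PowerSeries.coeff_zero_eq_constantCoeff_apply, PowerSeries.coeff_map] at this
    simpa using this.symm
  obtain ⟨V1, hV1⟩ := PowerSeries.X_dvd_iff.mpr h4
  rw [hV1, map_mul, PowerSeries.map_X] at h3
  have h5 := mul_left_cancel₀ PowerSeries.X_ne_zero h3
  have h6 : PowerSeries.constantCoeff V1 = ((1 : ℤˣ) : ℤ) := by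
    have := const_D
    rw [h5, ← PowerSeries.coeff_zero_eq_constantCoeff_apply, PowerSeries.coeff_map] at this
    simp only [PowerSeries.coeff_zero_eq_constantCoeff, eq_intCast] at this
    exact_mod_cast this
  refine ⟨PowerSeries.invOfUnit V1 1, ?_⟩
  rw [h5, ← map_mul, PowerSeries.mul_invOfUnit V1 1 h6, map_one]

lemma LL_int (n : ℕ) (hn : 1 ≤ n) : ∃ z : ℤ, LL (QQ wf) n (QQ (Eis 4)) / 4 = z := by
  obtain ⟨P, hP⟩ := Dinv_int
  obtain ⟨N, rfl⟩ : ∃ N, n = N + 1 := ⟨n - 1, by omega⟩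
  have hw : QQ wf = QQ (Eis 4) ^ 3 * P.map (Int.castRingHom ℂ) := by
    rw [← QQ_wf]; linear_combination (-QQ wf) * hP
  set R : PowerSeries ℤ := PowerSeries.mk fun m => (m : ℤ) * ((sigma 3 m : ℕ) : ℤ) with hR
  have hth : th (QQ (Eis 4)) = (PowerSeries.C 240 * R).map (Int.castRingHom ℂ) := by
    ext m
    rw [coeff_th, Q4_int]
    simp only [PowerSeries.coeff_map, map_add, PowerSeries.coeff_C_mul, PowerSeries.coeff_one, Sg, hR,
      PowerSeries.coeff_mk]
    rcases m with _ | m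
    · simp
    · simp; ring
  have hinv : QQ (Eis 4) * (QQ (Eis 4))⁻¹ = 1 :=
    PowerSeries.mul_inv_cancel _ (by rw [const_E 4 (by norm_num) (by decide)]; exact one_ne_zero)
  have hall : QQ wf ^ (N + 1) * (th (QQ (Eis 4)) * (QQ (Eis 4))⁻¹) =
      (PowerSeries.C 240 * ((1 + PowerSeries.C 240 * Sg 3) ^ (3 * N + 2) * P ^ (N + 1) * R)).map
        (Int.castRingHom ℂ) := by
    have e : PowerSeries.C 240 * ((1 + PowerSeries.C 240 * Sg 3) ^ (3 * N + 2) * P ^ (N + 1) * R)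
      = (1 + PowerSeries.C 240 * Sg 3) ^ (3 * N + 2) * P ^ (N + 1) * (PowerSeries.C 240 * R) := by ring
    rw [e, map_mul, map_mul, map_pow, map_pow, ← hth, ← Q4_int, hw]
    generalize th (QQ (Eis 4)) = t
    linear_combination (QQ (Eis 4) ^ (3 * N + 2) * (P.map (Int.castRingHom ℂ)) ^ (N + 1) * t) * hinv
  rw [LL, hall, PowerSeries.coeff_map, PowerSeries.coeff_C_mul]
  refine ⟨60 * PowerSeries.coeff (N + 1) ((1 + PowerSeries.C 240 * Sg 3) ^ (3 * N + 2) * P ^ (N + 1) * R), ?_⟩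
  simp only [eq_intCast]
  push_cast
  ring
end

lemma Eis_prod (k α β : ℕ) (hk : k = 4 * α + 6 * β) (hk14 : k = 0 ∨ 3 ≤ k) (hk2 : k < 12 ∨ k = 14)
    (z : ℂ) (hz : 0 < z.im) : Eis k z = Eis 4 z ^ α * Eis 6 z ^ β := by
  rcases hk14 with h | h
  · have ha : α = 0 := by omega
    have hb : β = 0 := by omega
    subst ha hb
    simp [h, Eis]
  · have h0 := Eis_eq h ⟨z, hz⟩
    have h4 := Eis_eq (k := 4) (by norm_num) ⟨z, hz⟩
    have h6 := Eis_eq (k := 6) (by norm_num) ⟨z, hz⟩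
    simp only at h0 h4 h6
    rw [h0, h4, h6]
    exact E_prod k α β hk h hk2 ⟨z, hz⟩

lemma good_lin (x : ℂ) : Good (fun z => wf z + -x * qexp z) ∧
    QQ (fun z => wf z + -x * qexp z) = QQ wf - PowerSeries.C x * PowerSeries.X := by
  have h1 := good_const (-x)
  have h2 := h1.1.mul good_qexp.1
  refine ⟨good_wf.add h2, ?_⟩
  rw [QQ_add good_wf h2, QQ_mul h1.1 good_qexp.1, h1.2, good_qexp.2, map_neg]
  ring

lemma main_aux (ℓ k' m n α β : ℕ) (hk : k' = 4 * α + 6 * β) (hk14 : k' = 0 ∨ 3 ≤ k')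
    (hk2 : k' < 12 ∨ k' = 14)
    (hm : m ≤ ℓ) (hn1 : 1 ≤ n) (hn2 : n ≤ ℓ - m)
    (f : ℂ → ℂ) (F : Polynomial ℂ)
    (hf : IsMillerForm ℓ k' m f) (hF : IsFaber ℓ k' m f F) :
    powerSumRoots F n
      = Acoef n * ((12 * ℓ + k' : ℕ) : ℂ) + Bcoef n * (m : ℂ) - β * 1728 ^ n / 2 := by
  obtain ⟨hdiff, -, -, a, ha, ha0⟩ := hf
  obtain ⟨hmon, hdeg, hfab⟩ := hF
  have hfg := good_of_hasSum hdiff a (fun z hz => by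
    rw [(ha z hz).2]; exact (ha z hz).1.hasSum)
  have hcard : F.roots.card = ℓ - m := by
    rw [← hdeg]; exact (IsAlgClosed.splits F).natDegree_eq_card_roots.symm
  have g4 := (good_E 4 (by norm_num)).1
  have g6 := (good_E 6 (by norm_num)).1
  have hp := good_prod F.roots (fun x z => wf z + -x * qexp z) (fun x => (good_lin x).1)
  have hE := (good_pow g4 α).1.mul (good_pow g6 β).1
  have hDE := (good_pow good_Df ℓ).1.mul hE
  have hU := hDE.mul hp.1
  have hQU : QQ _ = _ := QQ_mul hDE hp.1
  rw [QQ_mul (good_pow good_Df ℓ).1 hE, QQ_mul (good_pow g4 α).1 (good_pow g6 β).1, hp.2,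
    (good_pow good_Df ℓ).2, (good_pow g4 α).2, (good_pow g6 β).2] at hQU
  simp only [(good_lin _).2] at hQU
  have hfu : QQ f = PowerSeries.X ^ m * QQ (fun z => Df z ^ ℓ * (Eis 4 z ^ α * Eis 6 z ^ β) *
      (F.roots.map fun x => wf z + -x * qexp z).prod) := by
    rw [← good_qexp.2, ← (good_pow good_qexp.1 m).2, ← QQ_mul (good_pow good_qexp.1 m).1 hU]
    refine QQ_congr fun z hz => ?_
    rw [hfab z hz, Eis_prod k' α β hk hk14 hk2 z hz, Disc_Df]
    have h1 : F.eval (jinv z) = (F.roots.map fun x => jinv z - x).prod := by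
      conv_lhs => rw [(IsAlgClosed.splits F).eq_prod_roots_of_monic hmon]
      rw [Polynomial.eval_multiset_prod, Multiset.map_map]
      simp
    have h2 : (F.roots.map fun x => wf z + -x * qexp z).prod
        = qexp z ^ (ℓ - m) * F.eval (jinv z) := by
      rw [h1, ← hcard, ← Multiset.prod_replicate, ← Multiset.map_const', ← Multiset.prod_map_mul]
      congr 1
      refine Multiset.map_congr rfl fun x _ => ?_
      rw [jinv_wf z hz]
      have := qexp_ne z
      field_simp
      ring
    rw [h2, mul_pow]
    have h3 : qexp z ^ ℓ = qexp z ^ m * qexp z ^ (ℓ - m) := by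
      rw [← pow_add]; congr 1; omega
    rw [h3]; ring
  rw [hfg.2] at hfu
  have hmain := formal_main ℓ m n (QQ wf) (QQ Df) (QQ (Eis 4)) (QQ (Eis 6))
    (QQ (Eis 4) ^ α * QQ (Eis 6) ^ β) _ F.roots α β const_w const_D
    (const_E 4 (by norm_num) (by decide)) (const_E 6 (by norm_num) (by decide)) hn2 hm QQ_wf
    (by rw [QQ_E6, ← QQ_wf]; ring) hn1 rfl hcard rfl (by
      intro d hd1 hd2
      rw [← hQU]
      have h := congrArg (PowerSeries.coeff (d + m)) hfu
      rw [PowerSeries.coeff_mk, mul_comm, PowerSeries.coeff_mul_X_pow, ha0 _ (by omega),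
        if_neg (by omega)] at h
      exact h.symm)
  rw [powerSumRoots, hmain, Bcoef, cj_eq, Acoef_eq n hn1, hk]
  push_cast
  ring

/-- Theorem 1 of the paper.  Let `k = 12ℓ + k'`,
`k' ∈ {0,4,6,8,10,14}`, `0 ≤ m ≤ ℓ`, and let `x_1, …, x_{ℓ-m}` be the zeros of the
Faber polynomial `F_{k,m}` counted with multiplicity.  For every `1 ≤ n ≤ ℓ - m`,
`∑ x_i^n = A_n·k + B_n·m + C_n(k')`; moreover `A_n` is an integer. -/
theorem power_sums_linear (ℓ k' m n : ℕ)
    (hk' : k' = 0 ∨ k' = 4 ∨ k' = 6 ∨ k' = 8 ∨ k' = 10 ∨ k' = 14)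
    (hm : m ≤ ℓ) (hn1 : 1 ≤ n) (hn2 : n ≤ ℓ - m)
    (f : ℂ → ℂ) (F : Polynomial ℂ)
    (hf : IsMillerForm ℓ k' m f) (hF : IsFaber ℓ k' m f F) :
    powerSumRoots F n
      = Acoef n * ((12 * ℓ + k' : ℕ) : ℂ) + Bcoef n * (m : ℂ) + Ccoef n k' ∧
    ∃ z : ℤ, Acoef n = (z : ℂ) := by
  refine ⟨?_, ?_⟩
  · rcases hk' with h | h | h | h | h | h
    · rw [main_aux ℓ k' m n 0 0 (by omega) (by omega) (by omega) hm hn1 hn2 f F hf hF]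
      simp [Ccoef, h]
    · rw [main_aux ℓ k' m n 1 0 (by omega) (by omega) (by omega) hm hn1 hn2 f F hf hF]
      simp [Ccoef, h]
    · rw [main_aux ℓ k' m n 0 1 (by omega) (by omega) (by omega) hm hn1 hn2 f F hf hF]
      simp [Ccoef, h]; ring
    · rw [main_aux ℓ k' m n 2 0 (by omega) (by omega) (by omega) hm hn1 hn2 f F hf hF]
      simp [Ccoef, h]
    · rw [main_aux ℓ k' m n 1 1 (by omega) (by omega) (by omega) hm hn1 hn2 f F hf hF]
      simp [Ccoef, h]; ring
    · rw [main_aux ℓ k' m n 2 1 (by omega) (by omega) (by omega) hm hn1 hn2 f F hf hF]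
      simp [Ccoef, h]; ring
  · rw [Acoef_eq n hn1]
    exact LL_int n hn1
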